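/- arXiv:2511.06170 — 6 statements merged into one kernel-verified Lean document; each statement's English description precedes it below -/
import Mathlib

section
/- Let (X_t)_{t=0}^{n} be a martingale taking values in [0,1] with E[X_n] = a for some a ∈ (0,1]. Then E[max_{0 ≤ t ≤ n} X_t] ≤ a·(1 + ln(1/a)). -/
open MeasureTheory

/-- A filtration indexed by `Fin (n + 1)`, extended to `ℕ` as constant from time `n` on. -/
def MeasureTheory.Filtration.extendNat {Ω : Type*} {m : MeasurableSpace Ω} {n : ℕ}
    (ℱ : Filtration (Fin (n + 1)) m) : Filtration ℕ m where
  seq k := ℱ (Fin.ofNat (n + 1) (min k n))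
  mono' i j hij := ℱ.mono (by
    simp only [Fin.le_def, Fin.val_ofNat]
    rw [Nat.mod_eq_of_lt (by omega), Nat.mod_eq_of_lt (by omega)]
    omega)
  le' k := ℱ.le _

/-- A martingale indexed by `Fin (n + 1)`, extended to `ℕ` as constant from time `n` on,
is a martingale. -/
theorem MeasureTheory.Martingale.extendNat {Ω : Type*} {m : MeasurableSpace Ω} {μ : Measure Ω}
    {n : ℕ} {ℱ : Filtration (Fin (n + 1)) m} {X : Fin (n + 1) → Ω → ℝ}
    (hX : Martingale X ℱ μ) :
    Martingale (fun k : ℕ => X (Fin.ofNat (n + 1) (min k n))) ℱ.extendNat μ := by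
  refine ⟨fun k => hX.stronglyAdapted _, fun i j hij => hX.condExp_ae_eq ?_⟩
  simp only [Fin.le_def, Fin.val_ofNat]
  rw [Nat.mod_eq_of_lt (by omega), Nat.mod_eq_of_lt (by omega)]
  omega

/-- **Doob's maximal inequality** for a nonnegative martingale indexed by `Fin (n + 1)`. -/
theorem MeasureTheory.Martingale.mul_measureReal_le_iSup_le {Ω : Type*} {m : MeasurableSpace Ω}
    {μ : Measure Ω} [IsFiniteMeasure μ] {n : ℕ} {ℱ : Filtration (Fin (n + 1)) m}
    {X : Fin (n + 1) → Ω → ℝ} (hX : Martingale X ℱ μ) (hnonneg : 0 ≤ X) {t : ℝ} (ht : 0 ≤ t) :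
    t * μ.real {ω | t ≤ ⨆ i, X i ω} ≤ ∫ ω, X (Fin.last n) ω ∂μ := by
  have hlast : Fin.ofNat (n + 1) (min n n) = Fin.last n := by
    ext; simp
  have hsup : ∀ ω, ((Finset.range (n + 1)).sup' Finset.nonempty_range_add_one
      fun k => X (Fin.ofNat (n + 1) (min k n)) ω) = ⨆ i, X i ω := by
    intro ω
    apply le_antisymm
    · exact Finset.sup'_le _ _ fun k _ =>
        le_ciSup (f := fun i => X i ω) (Set.finite_range _).bddAbove _
    · refine ciSup_le fun i => ?_
      have hi : Fin.ofNat (n + 1) (min i n) = i := by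
        ext
        rw [Fin.val_ofNat, Nat.mod_eq_of_lt (by omega)]
        omega
      have := Finset.le_sup' (fun k : ℕ => X (Fin.ofNat (n + 1) (min k n)) ω)
        (Finset.mem_range.2 i.isLt)
      simpa only [hi] using this
  have h := maximal_ineq hX.extendNat.submartingale (fun k => hnonneg _) (ε := ⟨t, ht⟩) n
  simp only [hsup, hlast] at h
  have h' := ENNReal.toReal_mono ENNReal.ofReal_ne_top h
  rw [ENNReal.toReal_ofReal (integral_nonneg fun ω => hnonneg _ ω), ENNReal.toReal_mul] at h'
  exact h'.trans (setIntegral_le_integral (hX.integrable _)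
    (Filter.Eventually.of_forall fun ω => hnonneg _ ω))

/-- Let `(X_t)_{t=0}^n` be a martingale taking values in `[0,1]` with `E[X_n] = a`
for some `a ∈ (0,1]`.  Then `E[max_{0 ≤ t ≤ n} X_t] ≤ a·(1 + ln(1/a))`. -/
theorem martingale_expected_max_le
    {Ω : Type*} {m : MeasurableSpace Ω} {μ : Measure Ω} [IsProbabilityMeasure μ]
    {n : ℕ} (ℱ : Filtration (Fin (n + 1)) m) (X : Fin (n + 1) → Ω → ℝ)
    (hX : Martingale X ℱ μ)
    (hbdd : ∀ t ω, X t ω ∈ Set.Icc (0 : ℝ) 1)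
    {a : ℝ} (ha : a ∈ Set.Ioc (0 : ℝ) 1)
    (hE : ∫ ω, X (Fin.last n) ω ∂μ = a) :
    ∫ ω, (⨆ t, X t ω) ∂μ ≤ a * (1 + Real.log (1 / a)) := by
  obtain ⟨ha0, ha1⟩ := ha
  have hsup0 : ∀ ω, 0 ≤ ⨆ t, X t ω := fun ω => Real.iSup_nonneg fun t => (hbdd t ω).1
  have hsup1 : ∀ ω, ⨆ t, X t ω ≤ 1 := fun ω => ciSup_le fun t => (hbdd t ω).2
  have hmeas : Measurable fun ω => ⨆ t, X t ω :=
    Measurable.iSup fun t => ((hX.stronglyMeasurable t).mono (ℱ.le t)).measurable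
  have hint : Integrable (fun ω => ⨆ t, X t ω) μ :=
    Integrable.of_bound hmeas.aestronglyMeasurable 1
      (.of_forall fun ω => by rw [Real.norm_of_nonneg (hsup0 ω)]; exact hsup1 ω)
  have hanti : Antitone fun t : ℝ => μ.real {ω | t ≤ ⨆ i, X i ω} :=
    fun s t hst => measureReal_mono fun ω hω => hst.trans hω
  rw [hint.integral_eq_integral_Ioc_meas_le (.of_forall hsup0) (.of_forall hsup1),
    ← intervalIntegral.integral_of_le zero_le_one,
    ← intervalIntegral.integral_add_adjacent_intervals (b := a)
      hanti.intervalIntegrable hanti.intervalIntegrable]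
  have hinv : IntervalIntegrable (fun t : ℝ => a * t⁻¹) volume a 1 := by
    refine (intervalIntegrable_inv_iff.2 (.inr ?_)).const_mul a
    rw [Set.uIcc_of_le ha1]
    exact fun h => ha0.not_ge h.1
  have hlow : ∫ t in (0 : ℝ)..a, μ.real {ω | t ≤ ⨆ i, X i ω} ≤ a := by
    calc _ ≤ ∫ _ in (0 : ℝ)..a, (1 : ℝ) :=
          intervalIntegral.integral_mono_on ha0.le hanti.intervalIntegrable
            intervalIntegrable_const fun t _ => measureReal_le_one
      _ = a := by simp
  have hhigh : ∫ t in a..1, μ.real {ω | t ≤ ⨆ i, X i ω} ≤ a * Real.log (1 / a) := by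
    calc _ ≤ ∫ t in a..1, a * t⁻¹ := by
          refine intervalIntegral.integral_mono_on ha1 hanti.intervalIntegrable hinv fun t ht => ?_
          have ht0 : 0 < t := ha0.trans_le ht.1
          rw [← div_eq_mul_inv, le_div_iff₀' ht0, ← hE]
          exact hX.mul_measureReal_le_iSup_le (fun i ω => (hbdd i ω).1) ht0.le
      _ = a * Real.log (1 / a) := by
          rw [intervalIntegral.integral_const_mul, integral_inv_of_pos ha0 one_pos]
  linarith
end

section
/- Let T be a decision tree over {0,1}^n that computes f : {0,1}^n → {0,1} exactly, i.e. T(x) = f(x) for every x ∈ {0,1}^n. Then for every coordinate i ∈ [n], δ_i(T) ≥ Inf_i[f]; consequently, for every cost vector c ∈ ℝ_{≥0}^n, Σ_{i=1}^{n} c_i·δ_i(T) ≥ Σ_{i=1}^{n} c_i·Inf_i[f]. -/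
open Finset
open scoped Classical

noncomputable section

variable {ι : Type*} [Fintype ι] [DecidableEq ι]

/-- Probability of an event under the uniform distribution on `ι → Bool`. -/
def prU (p : (ι → Bool) → Prop) : ℝ :=
  ((Finset.univ.filter fun x => p x).card : ℝ) / (Fintype.card (ι → Bool) : ℝ)

/-- Expectation of a real-valued function under the uniform distribution on `ι → Bool`. -/
def expU (g : (ι → Bool) → ℝ) : ℝ :=
  (∑ x : ι → Bool, g x) / (Fintype.card (ι → Bool) : ℝ)

/-- `Inf_i[f]`: the influence of coordinate `i` on `f`. -/
def influence (f : (ι → Bool) → Bool) (i : ι) : ℝ :=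
  prU fun x => f x ≠ f (Function.update x i (!x i))

/-- `dist(f, g)`: probability that `f` and `g` disagree on a uniform random input. -/
def distU (f g : (ι → Bool) → Bool) : ℝ := prU fun x => f x ≠ g x

/-- `bias(f)`: the distance of `f` to the nearest constant function. -/
def biasU (f : (ι → Bool) → Bool) : ℝ :=
  min (distU f fun _ => false) (distU f fun _ => true)

/-- The restriction `f_π` of `f` under the partial assignment `π`, viewed as a function
on the full cube (the fixed coordinates are irrelevant, so probabilities/influences over
the full cube agree with those over the unfixed coordinates). -/
def restrictB (f : (ι → Bool) → Bool) (π : ι → Option Bool) : (ι → Bool) → Bool :=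
  fun x => f fun i => (π i).getD (x i)

/-- Decision trees over coordinate set `α`: internal nodes query a coordinate
(with a 0-child and a 1-child), leaves are labeled by bits. -/
inductive DTree (α : Type*) where
  | leaf : Bool → DTree α
  | node : α → DTree α → DTree α → DTree α

namespace DTree

/-- The output of the decision tree on input `x`. -/
def eval : DTree ι → (ι → Bool) → Bool
  | leaf b, _ => b
  | node j t0 t1, x => if x j then eval t1 x else eval t0 x

/-- The computation path of the tree on input `x` queries coordinate `i`. -/
def Queries : DTree ι → (ι → Bool) → ι → Prop
  | leaf _, _, _ => False
  | node j t0 t1, x, i =>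
      j = i ∨ (if x j then Queries t1 x i else Queries t0 x i)

end DTree

/-- `δ_i(T)`: probability that `T` queries coordinate `i` on a uniform random input. -/
def deltaU (T : DTree ι) (i : ι) : ℝ := prU fun x => T.Queries x i

/-- Changing a coordinate which the computation path does not query leaves the output unchanged. -/
theorem DTree.eval_update_of_not_queries {α : Type*} [DecidableEq α] {T : DTree α} {x : α → Bool}
    {i : α} (h : ¬ T.Queries x i) (b : Bool) : T.eval (Function.update x i b) = T.eval x := by
  induction T with
  | leaf => rfl
  | node j t0 t1 ih0 ih1 =>
    simp only [DTree.Queries, not_or] at h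
    obtain ⟨hji, h⟩ := h
    simp only [DTree.eval, Function.update_of_ne hji]
    split_ifs at h ⊢ with hx
    · exact ih1 h
    · exact ih0 h

theorem prU_mono {p q : (ι → Bool) → Prop} (h : ∀ x, p x → q x) : prU p ≤ prU q := by
  unfold prU
  gcongr with x
  exact h x

theorem influence_eval_le_deltaU (T : DTree ι) (i : ι) : influence T.eval i ≤ deltaU T i :=
  prU_mono fun _ hx => by_contra fun hq => hx (DTree.eval_update_of_not_queries hq _).symm

/-- If the decision tree `T` computes `f` exactly, then `δ_i(T) ≥ Inf_i[f]` for every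
coordinate `i`; consequently, for every nonnegative cost vector `c`,
`Σ_i c_i·δ_i(T) ≥ Σ_i c_i·Inf_i[f]`. -/
theorem delta_ge_influence_of_exact {n : ℕ} (f : (Fin n → Bool) → Bool)
    (T : DTree (Fin n)) (hT : ∀ x, T.eval x = f x) :
    (∀ i : Fin n, influence f i ≤ deltaU T i) ∧
      ∀ c : Fin n → ℝ, (∀ i, 0 ≤ c i) →
        ∑ i : Fin n, c i * influence f i ≤ ∑ i : Fin n, c i * deltaU T i := by
  obtain rfl : T.eval = f := funext hT
  have h := influence_eval_le_deltaU T
  exact ⟨h, fun c hc => Finset.sum_le_sum fun i _ => mul_le_mul_of_nonneg_left (h i) (hc i)⟩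
end
end

section
/- Let τ ∈ [0,1], let f : {0,1}^n → {0,1}, and let T be a decision tree over {0,1}^n that is everywhere τ-influential with respect to f. Then for every coordinate i ∈ [n], Inf_i[f] ≥ τ·δ_i(T). -/
open Finset
open scoped Classical

noncomputable section

variable {ι : Type*} [Fintype ι] [DecidableEq ι]

/-- `T` is everywhere `τ`-influential with respect to `f`, starting from the
restriction `π` (for the whole tree, take `π = fun _ => none`): every internal
node queries a coordinate whose influence on the restriction of `f` given by the
root-to-node path is at least `τ`. -/
def DTree.EverywhereInfluential (f : (ι → Bool) → Bool) (τ : ℝ) :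
    (ι → Option Bool) → DTree ι → Prop
  | _, .leaf _ => True
  | π, .node j t0 t1 =>
      τ ≤ influence (restrictB f π) j ∧
      DTree.EverywhereInfluential f τ (Function.update π j (some false)) t0 ∧
      DTree.EverywhereInfluential f τ (Function.update π j (some true)) t1

/-- The input obtained from `x` by overwriting the coordinates fixed by `π`. -/
def fillU (π : ι → Option Bool) (x : ι → Bool) : ι → Bool :=
  fun i => (π i).getD (x i)

lemma fillU_update_of_none {α : Type*} [DecidableEq α] {π : α → Option Bool} {j : α}
    (hj : π j = none) (b : Bool) (x : α → Bool) :
    fillU π (Function.update x j b) = fillU (Function.update π j (some b)) x := by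
  funext k
  by_cases hk : k = j
  · subst hk; simp [fillU, hj]
  · simp [fillU, hk]

lemma fillU_update_of_some {α : Type*} [DecidableEq α]
    {π : α → Option Bool} {j : α} {c : Bool} (hj : π j = some c)
    (b : Bool) (x : α → Bool) : fillU π (Function.update x j b) = fillU π x := by
  funext k
  by_cases hk : k = j
  · subst hk; simp [fillU, hj]
  · simp [fillU, hk]

lemma prU_nonneg (p : (ι → Bool) → Prop) : 0 ≤ prU p := by
  unfold prU; positivity

lemma prU_le_one (p : (ι → Bool) → Prop) : prU p ≤ 1 := by
  unfold prU
  refine div_le_one_of_le₀ ?_ (by positivity)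
  exact_mod_cast Finset.card_le_univ _

/-- Conditioning on the value of coordinate `j`. -/
lemma prU_eq_average_update (p : (ι → Bool) → Prop) (j : ι) :
    prU p = (prU (fun x => p (Function.update x j false)) +
      prU (fun x => p (Function.update x j true))) / 2 := by
  have flip : Function.Involutive fun x : ι → Bool => Function.update x j (!x j) := by
    intro x; simp
  have flip_sum : ∑ x : ι → Bool, (if p (Function.update x j (!x j)) then (1 : ℝ) else 0) =
      ∑ x : ι → Bool, if p x then (1 : ℝ) else 0 :=
    Equiv.sum_comp flip.toPerm fun x => if p x then (1 : ℝ) else 0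
  have split : ∑ x : ι → Bool, (if p (Function.update x j false) then (1 : ℝ) else 0) +
        ∑ x : ι → Bool, (if p (Function.update x j true) then (1 : ℝ) else 0) =
      ∑ x : ι → Bool, (if p x then (1 : ℝ) else 0) +
        ∑ x : ι → Bool, if p (Function.update x j (!x j)) then (1 : ℝ) else 0 := by
    rw [← Finset.sum_add_distrib, ← Finset.sum_add_distrib]
    refine Finset.sum_congr rfl fun x _ => ?_
    have self : Function.update x j (x j) = x := Function.update_eq_self j x
    cases hx : x j <;> rw [hx] at self <;> simp [self, add_comm]
  simp only [prU, Finset.natCast_card_filter]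
  rw [← add_div, split, flip_sum]
  ring

lemma influence_restrictB_of_some (f : (ι → Bool) → Bool) {π : ι → Option Bool} {j : ι}
    {c : Bool} (hj : π j = some c) : influence (restrictB f π) j = 0 := by
  have h (x : ι → Bool) :
      restrictB f π (Function.update x j (!x j)) = restrictB f π x :=
    congrArg f (fillU_update_of_some hj _ x)
  simp [influence, prU, h]

lemma influence_restrictB_of_none (f : (ι → Bool) → Bool) {π : ι → Option Bool} {i j : ι}
    (hj : π j = none) (hij : j ≠ i) :
    influence (restrictB f π) i =
      (influence (restrictB f (Function.update π j (some false))) i +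
        influence (restrictB f (Function.update π j (some true))) i) / 2 := by
  have h (b : Bool) (x : ι → Bool) : restrictB f π (Function.update x j b) =
      restrictB f (Function.update π j (some b)) x :=
    congrArg f (fillU_update_of_none hj b x)
  unfold influence
  rw [prU_eq_average_update _ j]
  simp only [Function.update_of_ne hij.symm, Function.update_comm hij, h]

/-- A subtree at restriction `π` bounds the influences of `f_π` from below. -/
lemma DTree.EverywhereInfluential.mul_prU_queries_le {f : (ι → Bool) → Bool} {τ : ℝ}
    (T : DTree ι) (π : ι → Option Bool) (hT : DTree.EverywhereInfluential f τ π T) (i : ι) :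
    τ * prU (fun x => T.Queries (fillU π x) i) ≤ influence (restrictB f π) i := by
  induction T generalizing π with
  | leaf b =>
    have h : prU (fun x => (DTree.leaf b).Queries (fillU π x) i) = 0 := by
      rw [prU, Finset.filter_eq_empty_iff.2 (by simp [DTree.Queries])]
      simp
    rw [h, mul_zero]
    exact prU_nonneg _
  | node j t0 t1 ih0 ih1 =>
    obtain ⟨hj, h0, h1⟩ := hT
    have hp := prU_nonneg fun x => (DTree.node j t0 t1).Queries (fillU π x) i
    have hp1 := prU_le_one fun x => (DTree.node j t0 t1).Queries (fillU π x) i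
    have hI : 0 ≤ influence (restrictB f π) i := prU_nonneg _
    rcases le_or_gt τ 0 with hτ | hτ
    · exact (mul_nonpos_of_nonpos_of_nonneg hτ hp).trans hI
    by_cases hij : j = i
    · subst hij
      exact (mul_le_of_le_one_right hτ.le hp1).trans hj
    cases hπ : π j with
    | some c => exact absurd hj (by rw [influence_restrictB_of_some f hπ]; exact hτ.not_ge)
    | none =>
      rw [influence_restrictB_of_none f hπ hij, prU_eq_average_update _ j]
      have fill (b : Bool) (x : ι → Bool) :
          fillU (Function.update π j (some b)) x j = b := by simp [fillU]
      simp only [fillU_update_of_none hπ, DTree.Queries, fill, hij, false_or, if_true,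
        Bool.false_eq_true, if_false]
      linarith [ih0 _ h0, ih1 _ h1]

/-- If `τ ∈ [0,1]` and `T` is everywhere `τ`-influential with respect to `f`, then
`Inf_i[f] ≥ τ·δ_i(T)` for every coordinate `i`. -/
theorem influence_ge_tau_mul_delta {n : ℕ} {τ : ℝ} (hτ : τ ∈ Set.Icc (0 : ℝ) 1)
    (f : (Fin n → Bool) → Bool) (T : DTree (Fin n))
    (hT : DTree.EverywhereInfluential f τ (fun _ => none) T) (i : Fin n) :
    τ * deltaU T i ≤ influence f i := by
  exact hT.mul_prU_queries_le T (fun _ => none) i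
end
end

section
/- Let w ≥ 1 be an integer and ε₀ ∈ [0, 1/4). Every decision tree T over {0,1}^{2^w · w} with dist(T, Tribes_w) ≤ ε₀ satisfies: the expected number, over a uniformly random input x, of tribe indices i ∈ [2^w] such that the computation path of T on x queries at least one of the coordinates x_{i,1}, …, x_{i,w}, is at least ((1/4 − ε₀)/2)·2^w. -/
open Finset
open scoped Classical

noncomputable section

variable {ι : Type*} [Fintype ι] [DecidableEq ι]

/-- The Tribes function with `2^w` tribes of width `w`:
`Tribes_w(x) = ⋁_{i ∈ [2^w]} ⋀_{j ∈ [w]} x_{i,j}`. -/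
def tribes (w : ℕ) : (Fin (2 ^ w) × Fin w → Bool) → Bool :=
  fun x => decide (∃ i : Fin (2 ^ w), ∀ j : Fin w, x (i, j) = true)

/-- A decision tree gives the same output on two inputs that agree on the coordinates
queried on the first of them. -/
theorem DTree.eval_eq_of_agree_on_queries {α : Type*} (T : DTree α) (x y : α → Bool)
    (h : ∀ i, T.Queries x i → y i = x i) : T.eval y = T.eval x := by
  induction T with
  | leaf b => rfl
  | node j t0 t1 ih0 ih1 =>
    have hj : y j = x j := h j (Or.inl rfl)
    simp only [DTree.eval, hj]
    by_cases hx : x j = true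
    · simp only [hx, if_true]
      exact ih1 fun i hi => h i (Or.inr (by simpa only [hx, if_true] using hi))
    · simp only [hx]
      exact ih0 fun i hi => h i (Or.inr (by rwa [if_neg hx]))

/-- Setting every coordinate of tribe `i` to `true`. -/
def fillTribe {w : ℕ} (x : Fin (2 ^ w) × Fin w → Bool) (i : Fin (2 ^ w)) :
    Fin (2 ^ w) × Fin w → Bool :=
  fun q => if q.1 = i then true else x q

theorem tribes_eq_false_iff {w : ℕ} (x : Fin (2 ^ w) × Fin w → Bool) :
    tribes w x = false ↔ ∀ i, ∃ j, x (i, j) = false := by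
  simp [tribes]

theorem tribes_fillTribe {w : ℕ} (x : Fin (2 ^ w) × Fin w → Bool) (i : Fin (2 ^ w)) :
    tribes w (fillTribe x i) = true := by
  simp only [tribes, decide_eq_true_eq]
  exact ⟨i, fun j => by simp [fillTribe]⟩

/-- The filled tribe is the only satisfied one, so it can be read off. -/
theorem index_eq_of_fillTribe_eq {w : ℕ} {x y : Fin (2 ^ w) × Fin w → Bool}
    {i k : Fin (2 ^ w)} (hy : tribes w y = false)
    (h : fillTribe x i = fillTribe y k) : i = k := by
  by_contra hne
  obtain ⟨j, hj⟩ := (tribes_eq_false_iff y).1 hy i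
  have := congrFun h (i, j)
  simp [fillTribe, hne, hj] at this

theorem eq_of_fillTribe_eq {w : ℕ} {x y : Fin (2 ^ w) × Fin w → Bool} {i : Fin (2 ^ w)}
    (h : fillTribe x i = fillTribe y i) (hrow : ∀ j, x (i, j) = y (i, j)) : x = y := by
  funext ⟨a, j⟩
  by_cases ha : a = i
  · subst ha
    exact hrow j
  · simpa [fillTribe, ha] using congrFun h (a, j)

/-- Each pair of a correctly rejected input and a tribe not revealed on it leads to a wrongly
rejected input, and at most `2 ^ w` pairs lead to the same one. -/
theorem card_unrevealed_le {w : ℕ} (T : DTree (Fin (2 ^ w) × Fin w)) :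
    (univ.filter fun p : (Fin (2 ^ w) × Fin w → Bool) × Fin (2 ^ w) =>
        (tribes w p.1 = false ∧ T.eval p.1 = false) ∧ ¬ ∃ j, T.Queries p.1 (p.2, j)).card ≤
      (univ.filter fun x => tribes w x = true ∧ T.eval x = false).card * 2 ^ w := by
  have hcard : (univ.filter fun x => tribes w x = true ∧ T.eval x = false).card * 2 ^ w =
      ((univ.filter fun x => tribes w x = true ∧ T.eval x = false) ×ˢ
        (univ : Finset (Fin w → Bool))).card := by
    simp [Finset.card_product]
  rw [hcard]
  refine Finset.card_le_card_of_injOn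
    (fun p => (fillTribe p.1 p.2, fun j => p.1 (p.2, j))) ?_ ?_
  · rintro ⟨x, i⟩ hp
    simp only [coe_filter, mem_univ, true_and, Set.mem_ofPred_eq] at hp
    obtain ⟨⟨-, hT⟩, hq⟩ := hp
    simp only [coe_product, coe_filter, mem_univ, true_and, coe_univ, Set.mem_prod,
      Set.mem_ofPred_eq, Set.mem_univ, and_true]
    refine ⟨tribes_fillTribe x i, ?_⟩
    rw [← hT]
    refine T.eval_eq_of_agree_on_queries x _ ?_
    rintro ⟨a, j⟩ haj
    have ha : a ≠ i := by
      rintro rfl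
      exact hq ⟨j, haj⟩
    simp [fillTribe, ha]
  · rintro ⟨x, i⟩ - ⟨y, k⟩ hp h
    simp only [coe_filter, mem_univ, true_and, Set.mem_ofPred_eq] at hp
    obtain ⟨h1, h2⟩ := Prod.mk.inj h
    obtain rfl : i = k := index_eq_of_fillTribe_eq hp.1.1 h1
    exact congrArg (·, i) (eq_of_fillTribe_eq h1 (congrFun h2))

/-- Counting pairs of a correctly rejected input and a tribe, revealed or not. -/
theorem card_correct_mul_le {w : ℕ} (T : DTree (Fin (2 ^ w) × Fin w)) :
    (univ.filter fun x => tribes w x = false ∧ T.eval x = false).card * 2 ^ w ≤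
      (∑ x, (univ.filter fun i : Fin (2 ^ w) => ∃ j, T.Queries x (i, j)).card) +
        (univ.filter fun x => tribes w x = true ∧ T.eval x = false).card * 2 ^ w := by
  refine le_trans ?_ (Nat.add_le_add_left (card_unrevealed_le T) _)
  have hU : (univ.filter fun p : (Fin (2 ^ w) × Fin w → Bool) × Fin (2 ^ w) =>
        (tribes w p.1 = false ∧ T.eval p.1 = false) ∧ ¬ ∃ j, T.Queries p.1 (p.2, j)).card =
      ∑ x ∈ univ.filter (fun x => tribes w x = false ∧ T.eval x = false),
        (univ.filter fun i : Fin (2 ^ w) => ¬ ∃ j, T.Queries x (i, j)).card := by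
    rw [Finset.card_filter, Fintype.sum_prod_type, Finset.sum_filter]
    refine Finset.sum_congr rfl fun x _ => ?_
    by_cases hx : tribes w x = false ∧ T.eval x = false
    · simp only [hx, and_self, true_and, if_true, Finset.card_filter]
    · simp only [hx, false_and, if_false, Finset.sum_const_zero]
  have hsplit : (univ.filter fun x => tribes w x = false ∧ T.eval x = false).card * 2 ^ w =
      ∑ x ∈ univ.filter (fun x => tribes w x = false ∧ T.eval x = false),
        ((univ.filter fun i : Fin (2 ^ w) => ∃ j, T.Queries x (i, j)).card +
        (univ.filter fun i : Fin (2 ^ w) => ¬ ∃ j, T.Queries x (i, j)).card) := by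
    simp only [Finset.card_filter_add_card_filter_not, Finset.card_univ, Fintype.card_fin,
      Finset.sum_const, smul_eq_mul]
  rw [hU, hsplit, Finset.sum_add_distrib]
  gcongr
  exact Finset.filter_subset _ _

theorem card_tribes_eq_false (w : ℕ) :
    (univ.filter fun x => tribes w x = false).card = (2 ^ w - 1) ^ 2 ^ w := by
  have hpi : (Fintype.piFinset fun _ : Fin (2 ^ w) =>
      (univ.erase fun _ => true : Finset (Fin w → Bool))).card = (2 ^ w - 1) ^ 2 ^ w := by
    simp [Fintype.card_piFinset, Finset.card_erase_of_mem]
  rw [← hpi]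
  refine Finset.card_equiv (Equiv.curry (Fin (2 ^ w)) (Fin w) Bool) fun x => ?_
  simp [tribes_eq_false_iff, funext_iff]

/-- Tribes rejects at least a quarter of the cube. -/
theorem card_cube_le_four_mul_card_tribes_eq_false {w : ℕ} (hw : 1 ≤ w) :
    (Fintype.card (Fin (2 ^ w) × Fin w → Bool) : ℝ) ≤
      4 * ((univ.filter fun x => tribes w x = false).card : ℝ) := by
  rw [card_tribes_eq_false]
  obtain ⟨k, rfl⟩ : ∃ k, w = k + 1 := ⟨w - 1, by omega⟩
  have hcube : (Fintype.card (Fin (2 ^ (k + 1)) × Fin (k + 1) → Bool) : ℝ) =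
      ((2 : ℝ) ^ (k + 1)) ^ 2 ^ (k + 1) := by
    simp [← pow_mul, mul_comm]
  rw [hcube, Nat.cast_pow, Nat.cast_sub Nat.one_le_two_pow]
  push_cast
  have hN : (0 : ℝ) < 2 ^ (k + 1) := by positivity
  have hinv : ((2 : ℝ) ^ (k + 1))⁻¹ ≤ 1 :=
    inv_le_one_of_one_le₀ (one_le_pow₀ (by norm_num))
  have bernoulli := one_add_mul_le_pow (a := -((2 : ℝ) ^ (k + 1))⁻¹) (by linarith) (2 ^ k)
  have hhalf : 1 + ((2 ^ k : ℕ) : ℝ) * -((2 : ℝ) ^ (k + 1))⁻¹ = 1 / 2 := by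
    push_cast
    field_simp
    ring
  rw [hhalf] at bernoulli
  have hquarter : (1 : ℝ) / 4 ≤ (1 + -((2 : ℝ) ^ (k + 1))⁻¹) ^ 2 ^ (k + 1) := by
    have hsq : (2 : ℕ) ^ (k + 1) = 2 ^ k + 2 ^ k := by ring
    rw [hsq, pow_add]
    nlinarith
  have hfactor : (2 : ℝ) ^ (k + 1) - 1 = 2 ^ (k + 1) * (1 + -((2 : ℝ) ^ (k + 1))⁻¹) := by
    field_simp
    ring
  rw [hfactor, mul_pow]
  have hpos : (0 : ℝ) < ((2 : ℝ) ^ (k + 1)) ^ 2 ^ (k + 1) := by positivity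
  nlinarith

/-- For `w ≥ 1` and `ε₀ ∈ [0, 1/4)`, every decision tree `T` with
`dist(T, Tribes_w) ≤ ε₀` reveals, in expectation over a uniform random input, at least
`((1/4 − ε₀)/2)·2^w` tribes: the expected number of indices `i ∈ [2^w]` such that the
computation path queries some coordinate `x_{i,j}` is at least `((1/4 − ε₀)/2)·2^w`. -/
theorem tribes_revealed_tribes_lower_bound (w : ℕ) (hw : 1 ≤ w)
    (ε₀ : ℝ) (hε₀ : 0 ≤ ε₀) (hε₁ : ε₀ < 1 / 4)
    (T : DTree (Fin (2 ^ w) × Fin w)) (hT : distU T.eval (tribes w) ≤ ε₀) :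
    ((1 / 4 - ε₀) / 2) * 2 ^ w ≤
      expU (fun x =>
        ((Finset.univ.filter fun i : Fin (2 ^ w) =>
          ∃ j : Fin w, T.Queries x (i, j)).card : ℝ)) := by
  have hC : (0 : ℝ) < Fintype.card (Fin (2 ^ w) × Fin w → Bool) := by
    exact_mod_cast Fintype.card_pos
  have hreject := card_cube_le_four_mul_card_tribes_eq_false hw
  have hcount := card_correct_mul_le T
  have hrejectSplit : (univ.filter fun x => tribes w x = false).card =
      (univ.filter fun x => tribes w x = false ∧ T.eval x = false).card +
      (univ.filter fun x => tribes w x = false ∧ T.eval x = true).card := by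
    rw [← Finset.card_filter_add_card_filter_not (fun x => T.eval x = false),
      Finset.filter_filter, Finset.filter_filter]
    simp only [Bool.not_eq_false]
  have herrorSplit : (univ.filter fun x => T.eval x ≠ tribes w x).card =
      (univ.filter fun x => tribes w x = true ∧ T.eval x = false).card +
      (univ.filter fun x => tribes w x = false ∧ T.eval x = true).card := by
    rw [← Finset.card_filter_add_card_filter_not (fun x => T.eval x = false),
      Finset.filter_filter, Finset.filter_filter]
    congr 2 <;> ext x <;> cases hx : T.eval x <;> cases hy : tribes w x <;> simp [hx, hy]
  rw [distU, prU, div_le_iff₀ hC] at hT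
  replace hT := (congrArg (Nat.cast (R := ℝ)) herrorSplit).symm.trans_le
    (le_of_eq_of_le (by congr) hT)
  rw [hrejectSplit] at hreject
  rw [expU, le_div_iff₀ hC]
  have hcountReal := (Nat.cast_le (α := ℝ)).2 hcount
  push_cast at hcountReal hT hreject
  have hN : (0 : ℝ) < 2 ^ w := by positivity
  have hmargin : (1 / 4 - ε₀) * (Fintype.card (Fin (2 ^ w) × Fin w → Bool) : ℝ) ≤
      ((univ.filter fun x => tribes w x = false ∧ T.eval x = false).card : ℝ) -
      ((univ.filter fun x => tribes w x = true ∧ T.eval x = false).card : ℝ) := by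
    linarith
  have hscaled := mul_le_mul_of_nonneg_right hmargin hN.le
  have hnonneg : 0 ≤ (1 / 4 - ε₀) *
      (Fintype.card (Fin (2 ^ w) × Fin w → Bool) : ℝ) * 2 ^ w := by
    have : 0 ≤ 1 / 4 - ε₀ := by linarith
    positivity
  linarith
end
end

section
/- There is a universal constant α > 0 such that the following holds for every n ≥ 1 and every ε ∈ (0, 1/2]: if f : {0,1}^n → {0,1} is symmetric and bias(f) ≥ ε, then E_{x ~ uniform({0,1}^n)}[τ^(0)(x)] ≥ α·n/log₂(1/ε), where when ε = 1/2 the denominator log₂(1/ε) is 1. -/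
open Finset
open scoped Classical

noncomputable section

variable {ι : Type*} [Fintype ι] [DecidableEq ι]

/-- A symmetric Boolean function: `f x` depends only on the Hamming weight of `x`. -/
def IsSymmetricFn {n : ℕ} (f : (Fin n → Bool) → Bool) : Prop :=
  ∀ x y : Fin n → Bool,
    (Finset.univ.filter fun i => x i = true).card =
      (Finset.univ.filter fun i => y i = true).card → f x = f y

/-- The restriction of `f` fixing the first `t` coordinates to those of `x`. -/
def restrictFirst {n : ℕ} (f : (Fin n → Bool) → Bool) (x : Fin n → Bool) (t : ℕ) :
    (Fin n → Bool) → Bool :=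
  fun y => f fun i => if (i : ℕ) < t then x i else y i

/-- `τ^(ε)(x)`: the smallest `t ∈ {0, …, n}` such that fixing the first `t` coordinates
to `x_1, …, x_t` yields a function of bias at most `ε` (at `t = n` the restriction is a
constant, so the set is nonempty whenever `ε ≥ 0`). -/
def tauStop {n : ℕ} (f : (Fin n → Bool) → Bool) (ε : ℝ) (x : Fin n → Bool) : ℕ :=
  sInf {t : ℕ | biasU (restrictFirst f x t) ≤ ε}

/-- The restriction fixing all coordinates has bias at most `0`. -/
lemma biasU_restrictFirst_self {n : ℕ} (f : (Fin n → Bool) → Bool) (x : Fin n → Bool) :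
    biasU (restrictFirst f x n) ≤ 0 := by
  have h : ∀ y, restrictFirst f x n y = f x := fun y => by simp [restrictFirst]
  unfold biasU distU prU
  simp only [h]
  cases f x <;> simp

/-- A function of bias at most `0` is constant. -/
lemma exists_const_of_biasU_le_zero {n : ℕ} {f : (Fin n → Bool) → Bool} (h : biasU f ≤ 0) :
    ∃ c, ∀ y, f y = c := by
  have key : ∀ c : Bool, distU f (fun _ => c) ≤ 0 → ∀ y, f y = c := by
    intro c hc y
    by_contra hy
    have hpos : 0 < distU f (fun _ => c) := by
      unfold distU prU
      exact div_pos (Nat.cast_pos.mpr (Finset.card_pos.mpr ⟨y, by simpa using hy⟩))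
        (by positivity)
    linarith
  rcases min_le_iff.mp h with h | h
  · exact ⟨_, key _ h⟩
  · exact ⟨_, key _ h⟩

/-- The restriction of `f` at its stopping time for `ε = 0` is constant. -/
lemma exists_const_restrictFirst_tauStop {n : ℕ} (f : (Fin n → Bool) → Bool)
    (x : Fin n → Bool) : ∃ c, ∀ y, restrictFirst f x (tauStop f 0 x) y = c := by
  have h := Nat.sInf_mem (s := {t : ℕ | biasU (restrictFirst f x t) ≤ 0})
    ⟨n, biasU_restrictFirst_self f x⟩
  exact exists_const_of_biasU_le_zero h

lemma biasU_le_distU_const {n : ℕ} (f : (Fin n → Bool) → Bool) (c : Bool) :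
    biasU f ≤ distU f fun _ => c := by
  cases c
  · exact min_le_left _ _
  · exact min_le_right _ _

/-- A function of positive bias is not constant at time `0`. -/
lemma one_le_tauStop {n : ℕ} {f : (Fin n → Bool) → Bool} (hf : 0 < biasU f)
    (x : Fin n → Bool) : 1 ≤ tauStop f 0 x := by
  by_contra hlt
  have h0 : tauStop f 0 x = 0 := by omega
  obtain ⟨c, hc⟩ := exists_const_restrictFirst_tauStop f x
  have hc' : ∀ y, f y = c := fun y => by simpa [h0, restrictFirst] using hc y
  have := biasU_le_distU_const f c
  have hz : distU f (fun _ => c) = 0 := by simp [distU, prU, hc']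
  linarith

/-- Exponential Markov bound for the number of points with few coordinates equal to `b`. -/
lemma card_filter_lt_le {n : ℕ} (b : Bool) (t : ℕ) :
    (((Finset.univ : Finset (Fin n → Bool)).filter fun x =>
      (Finset.univ.filter fun i => x i = b).card < t).card : ℝ) ≤ 4 ^ t * (5 / 4) ^ n := by
  have hsum : ∑ x : Fin n → Bool, (1 / 4 : ℝ) ^ (Finset.univ.filter fun i => x i = b).card
      = (5 / 4) ^ n := by
    have h1 : ∀ x : Fin n → Bool, (1 / 4 : ℝ) ^ (Finset.univ.filter fun i => x i = b).card
        = ∏ i, if x i = b then (1 / 4 : ℝ) else 1 := by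
      intro x
      rw [Finset.prod_ite]
      simp
    simp_rw [h1]
    rw [← Fintype.prod_sum (fun (_ : Fin n) (a : Bool) => if a = b then (1 / 4 : ℝ) else 1)]
    cases b <;> norm_num [div_pow]
  have hle : (((Finset.univ : Finset (Fin n → Bool)).filter fun x =>
      (Finset.univ.filter fun i => x i = b).card < t).card : ℝ) * (1 / 4) ^ t
      ≤ (5 / 4) ^ n := by
    rw [← hsum, ← nsmul_eq_mul]
    refine (Finset.card_nsmul_le_sum _ _ _ ?_).trans
      (Finset.sum_le_sum_of_subset_of_nonneg (Finset.subset_univ _) fun _ _ _ => by positivity)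
    intro x hx
    exact pow_le_pow_of_le_one (by norm_num) (by norm_num) (Finset.mem_filter.mp hx).2.le
  have h4 : (4 : ℝ) ^ t * (1 / 4) ^ t = 1 := by rw [← mul_pow]; norm_num
  calc _ = 4 ^ t * (_ * (1 / 4 : ℝ) ^ t) := by rw [mul_left_comm, h4, mul_one]
    _ ≤ _ := by gcongr

/-- If a symmetric function becomes constant after fixing its first `t` coordinates, it takes
the same value at every point with at least `t` ones and at least `t` zeros. -/
lemma IsSymmetricFn.eq_of_restrictFirst_const {n t : ℕ} {f : (Fin n → Bool) → Bool}
    (hf : IsSymmetricFn f) (ht : t ≤ n) {x : Fin n → Bool} {c : Bool}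
    (hc : ∀ y, restrictFirst f x t y = c) {y : Fin n → Bool}
    (h1 : t ≤ (Finset.univ.filter fun i => y i = true).card)
    (h0 : t ≤ (Finset.univ.filter fun i => y i = false).card) : f y = c := by
  set w := (Finset.univ.filter fun i => y i = true).card with hw
  have hadd : w + (Finset.univ.filter fun i => y i = false).card = n := by
    have := Finset.card_filter_add_card_filter_not (s := (Finset.univ : Finset (Fin n)))
      (fun i => y i = true)
    simpa using this
  have hlow : (Finset.univ.filter fun i : Fin n => (i : ℕ) < t).card = t := by
    rw [Fin.card_filter_val_lt, min_eq_right ht]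
  have hhigh : (Finset.univ.filter fun i : Fin n => ¬ (i : ℕ) < t).card = n - t := by
    have := Finset.card_filter_add_card_filter_not (s := (Finset.univ : Finset (Fin n)))
      (fun i => (i : ℕ) < t)
    rw [hlow, Finset.card_univ, Fintype.card_fin] at this
    omega
  set A := Finset.univ.filter fun i : Fin n => (i : ℕ) < t ∧ x i = true with hA
  have hAt : A.card ≤ t := by
    rw [← hlow]
    exact Finset.card_le_card fun i hi => by
      simp only [hA, Finset.mem_filter, Finset.mem_univ, true_and] at hi ⊢
      exact hi.1
  obtain ⟨S, hS, hScard⟩ := Finset.exists_subset_card_eq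
    (s := Finset.univ.filter fun i : Fin n => ¬ (i : ℕ) < t) (n := w - A.card) (by omega)
  have hSt : ∀ i ∈ S, ¬ (i : ℕ) < t := fun i hi => (Finset.mem_filter.mp (hS hi)).2
  have hdisj : Disjoint A S := Finset.disjoint_left.mpr fun i hi hi' =>
    hSt i hi' (Finset.mem_filter.mp hi).2.1
  rw [← hc fun i => decide (i ∈ S)]
  refine hf _ _ ?_
  have hunion : (Finset.univ.filter fun i : Fin n =>
      (if (i : ℕ) < t then x i else decide (i ∈ S)) = true) = A ∪ S := by
    ext i
    have := hSt i
    by_cases hi : (i : ℕ) < t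
    · simp [hA, hi]
      tauto
    · simp [hA, hi]
  rw [hunion, Finset.card_union_of_disjoint hdisj, hScard, ← hw]
  omega

/-- A symmetric function that becomes constant after few coordinates are fixed has
exponentially small bias. -/
lemma IsSymmetricFn.biasU_le_of_restrictFirst_const {n t : ℕ} {f : (Fin n → Bool) → Bool}
    (hf : IsSymmetricFn f) (ht : t ≤ n) {x : Fin n → Bool} {c : Bool}
    (hc : ∀ y, restrictFirst f x t y = c) : biasU f ≤ 2 * 4 ^ t * (5 / 8) ^ n := by
  refine (biasU_le_distU_const f c).trans ?_
  unfold distU prU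
  have hsub : (Finset.univ.filter fun y => f y ≠ c) ⊆
      ((Finset.univ : Finset (Fin n → Bool)).filter fun y =>
        (Finset.univ.filter fun i => y i = true).card < t) ∪
      ((Finset.univ : Finset (Fin n → Bool)).filter fun y =>
        (Finset.univ.filter fun i => y i = false).card < t) := by
    intro y hy
    simp only [Finset.mem_filter, Finset.mem_univ, true_and, Finset.mem_union] at hy ⊢
    by_contra! h
    exact hy (hf.eq_of_restrictFirst_const ht hc h.1 h.2)
  have hcard : ((Finset.univ.filter fun y => f y ≠ c).card : ℝ) ≤
      4 ^ t * (5 / 4) ^ n + 4 ^ t * (5 / 4) ^ n := by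
    refine le_trans ?_ (add_le_add (card_filter_lt_le true t) (card_filter_lt_le false t))
    exact_mod_cast (Finset.card_le_card hsub).trans (Finset.card_union_le _ _)
  have h58 : (5 / 8 : ℝ) ^ n * 2 ^ n = (5 / 4) ^ n := by rw [← mul_pow]; norm_num
  have hcube : (Fintype.card (Fin n → Bool) : ℝ) = 2 ^ n := by simp
  rw [hcube, div_le_iff₀ (by positivity), mul_assoc, h58]
  calc _ = ((Finset.univ.filter fun y => f y ≠ c).card : ℝ) := by congr!
    _ ≤ _ := by linarith

lemma le_expU_of_forall_le {n : ℕ} {g : (Fin n → Bool) → ℝ} {a : ℝ} (h : ∀ x, a ≤ g x) :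
    a ≤ expU g := by
  unfold expU
  rw [le_div_iff₀ (by positivity), mul_comm, ← nsmul_eq_mul]
  exact Finset.card_nsmul_le_sum _ _ _ fun x _ => h x

/-- A bias bound `2 * 4 ^ t * (5 / 8) ^ n` with `8 * t < n` forces `log₂ (1 / ε)` to be
linear in `n`. -/
lemma le_logb_of_le_tail {n t : ℕ} {ε : ℝ} (hε : 0 < ε) (ht : 8 * t < n)
    (h : ε ≤ 2 * 4 ^ t * (5 / 8) ^ n) : (n : ℝ) ≤ 4 * (Real.logb 2 (1 / ε) + 1) := by
  have h8 : ε ^ 8 ≤ 2 ^ 8 * (1 / 4) ^ n := by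
    calc ε ^ 8 ≤ (2 * 4 ^ t * (5 / 8) ^ n) ^ 8 := by gcongr
      _ = 2 ^ 8 * 4 ^ (8 * t) * ((5 / 8) ^ 8) ^ n := by
        rw [mul_pow, mul_pow, ← pow_mul, ← pow_mul, ← pow_mul, mul_comm t, mul_comm n]
      _ ≤ 2 ^ 8 * 4 ^ n * ((5 / 8) ^ 8) ^ n := by
        gcongr
        norm_num
      _ = 2 ^ 8 * (4 * (5 / 8) ^ 8) ^ n := by rw [mul_pow, mul_assoc]
      _ ≤ 2 ^ 8 * (1 / 4) ^ n := by
        gcongr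
        norm_num
  have hlog := Real.logb_le_logb_of_le (b := 2) (by norm_num) (by positivity) h8
  rw [Real.logb_mul (by positivity) (by positivity), Real.logb_pow, Real.logb_pow,
    Real.logb_pow, Real.logb_self_eq_one (by norm_num)] at hlog
  have hq : Real.logb 2 (1 / 4) = -2 := by
    rw [show (1 / 4 : ℝ) = 2 ^ (-2 : ℝ) by norm_num [Real.rpow_neg], Real.logb_rpow] <;> norm_num
  rw [hq] at hlog
  rw [one_div, Real.logb_inv]
  push_cast at hlog
  linarith

/-- There is a universal constant `α > 0` such that for every `n ≥ 1`, `ε ∈ (0, 1/2]` and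
symmetric `f : {0,1}^n → {0,1}` with `bias(f) ≥ ε`, we have
`E_x[τ^(0)(x)] ≥ α·n / log₂(1/ε)` (when `ε = 1/2` the denominator `log₂(1/ε)` is `1`). -/
theorem symmetric_tau_zero_expectation_lower_bound :
    ∃ α : ℝ, 0 < α ∧
      ∀ n : ℕ, 1 ≤ n → ∀ ε : ℝ, 0 < ε → ε ≤ 1 / 2 →
        ∀ f : (Fin n → Bool) → Bool, IsSymmetricFn f → ε ≤ biasU f →
          α * n / Real.logb 2 (1 / ε) ≤ expU (fun x : Fin n → Bool => (tauStop f 0 x : ℝ)) := by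
  refine ⟨1 / 8, by norm_num, fun n hn ε hε hε2 f hf hbias => ?_⟩
  have hL : 1 ≤ Real.logb 2 (1 / ε) := by
    rw [Real.le_logb_iff_rpow_le (by norm_num) (by positivity), Real.rpow_one,
      le_div_iff₀ hε]
    linarith
  rw [div_le_iff₀ (by linarith)]
  have hn0 : (0 : ℝ) ≤ n := n.cast_nonneg
  by_cases hall : ∀ x, n ≤ 8 * tauStop f 0 x
  · have hE : (n : ℝ) / 8 ≤ expU fun x : Fin n → Bool => (tauStop f 0 x : ℝ) := by
      refine le_expU_of_forall_le fun x => ?_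
      have : (n : ℝ) ≤ 8 * tauStop f 0 x := by exact_mod_cast hall x
      linarith
    nlinarith
  · push Not at hall
    obtain ⟨x, hx⟩ := hall
    obtain ⟨c, hc⟩ := exists_const_restrictFirst_tauStop f x
    have hlog := le_logb_of_le_tail hε hx
      (hbias.trans (hf.biasU_le_of_restrictFirst_const (by omega) hc))
    have hE : 1 ≤ expU fun x : Fin n → Bool => (tauStop f 0 x : ℝ) :=
      le_expU_of_forall_le fun x => by exact_mod_cast one_le_tauStop (hε.trans_le hbias) x
    nlinarith
end
end

section
/- Let f : {0,1}^n → {0,1} with a := Inf_i[f] ∈ (0,1] for a coordinate i ∈ [n], and let T be any decision tree over {0,1}^n. For a uniformly random x ~ uniform({0,1}^n), let π_0 ⊆ π_1 ⊆ … ⊆ π_L denote the successive restrictions along the computation path of T on x (π_t fixes the first t coordinates queried, to the corresponding bits of x), and define Y_t := Inf_i[f_{π_s}] where s is the largest index ≤ t such that coordinate i is not fixed by π_s (i.e. the value of Inf_i[f_{π_t}] is frozen at its last value before coordinate i is queried). Then E_{x}[max_{0 ≤ t ≤ L} Y_t] ≤ a·(1 + ln(1/a)). -/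
open Finset
open scoped Classical

noncomputable section

variable {ι : Type*} [Fintype ι] [DecidableEq ι]

/-- The maximum, along the computation path of the tree on input `x` started from the
restriction `π`, of the quantities `Y_t = Inf_i[f_{π_s}]`, where `π_t` is the restriction
after `t` queries and `s` is the largest index `≤ t` with coordinate `i` not yet fixed
(i.e. the value of `Inf_i[f_{π_t}]` is frozen at its last value before `i` is queried;
once `i` is queried, all subsequent values equal the current one, so the maximum of the
remaining path is the current influence). -/
def maxPathInf (f : (ι → Bool) → Bool) (i : ι) :
    (ι → Option Bool) → DTree ι → (ι → Bool) → ℝ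
  | π, .leaf _, _ => influence (restrictB f π) i
  | π, .node j t0 t1, x =>
      if j = i then influence (restrictB f π) i
      else
        max (influence (restrictB f π) i)
          (if x j then maxPathInf f i (Function.update π j (some true)) t1 x
            else maxPathInf f i (Function.update π j (some false)) t0 x)

/-- The point obtained from `x` by overwriting the coordinates fixed by `π`. -/
def overlay (π : ι → Option Bool) (x : ι → Bool) : ι → Bool :=
  fun k => (π k).getD (x k)

lemma overlay_update {κ : Type*} [DecidableEq κ] (π : κ → Option Bool) (x : κ → Bool) {j : κ}
    (hj : π j = none) (b : Bool) :
    overlay π (Function.update x j b) = overlay (Function.update π j (some b)) x := by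
  funext k
  by_cases h : k = j
  · subst h; simp [overlay, hj]
  · simp [overlay, h]

lemma expU_mono {g h : (ι → Bool) → ℝ} (hgh : ∀ x, g x ≤ h x) : expU g ≤ expU h := by
  unfold expU
  gcongr with x
  exact hgh x

lemma expU_const (c : ℝ) : expU (fun _ : ι → Bool => c) = c := by
  simp [expU]

lemma sum_update_not (g : (ι → Bool) → ℝ) (j : ι) :
    ∑ x, g (Function.update x j (!x j)) = ∑ x, g x := by
  refine Fintype.sum_bijective (fun x : ι → Bool => Function.update x j (!x j))
    (Function.Involutive.bijective fun x => ?_) _ _ fun _ => rfl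
  simp

/-- Averaging over the value of a single coordinate. -/
lemma expU_eq_avg (g : (ι → Bool) → ℝ) (j : ι) :
    expU g = (expU (fun x => g (Function.update x j true)) +
      expU (fun x => g (Function.update x j false))) / 2 := by
  have hpair : ∑ x, (g (Function.update x j true) + g (Function.update x j false)) =
      ∑ x, (g x + g (Function.update x j (!x j))) := by
    refine Finset.sum_congr rfl fun x _ => ?_
    have hx : Function.update x j (x j) = x := Function.update_eq_self j x
    cases hb : x j <;> rw [hb] at hx <;> simp [hx, add_comm]
  rw [Finset.sum_add_distrib, Finset.sum_add_distrib, sum_update_not] at hpair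
  unfold expU
  rw [← add_div, hpair]
  ring

lemma prU_eq_expU (p : (ι → Bool) → Prop) : prU p = expU fun x => if p x then 1 else 0 := by
  simp [prU, expU]

lemma influence_nonneg (f : (ι → Bool) → Bool) (i : ι) : 0 ≤ influence f i := by
  unfold influence prU
  positivity

lemma influence_le_one (f : (ι → Bool) → Bool) (i : ι) : influence f i ≤ 1 := by
  rw [influence, prU_eq_expU]
  refine (expU_mono fun x => ?_).trans (expU_const (ι := ι) 1).le
  split_ifs <;> norm_num

/-- Querying a free coordinate `j ≠ i` makes the influence of `i` a martingale step. -/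
lemma influence_restrictB_eq_avg (f : (ι → Bool) → Bool) {i j : ι} (hij : j ≠ i)
    {π : ι → Option Bool} (hj : π j = none) :
    influence (restrictB f π) i =
      (influence (restrictB f (Function.update π j (some true))) i +
        influence (restrictB f (Function.update π j (some false))) i) / 2 := by
  have hrestrict : ∀ (b : Bool) (x : ι → Bool),
      restrictB f (Function.update π j (some b)) x = restrictB f π (Function.update x j b) :=
    fun b x => congrArg f (overlay_update π x hj b).symm
  simp only [influence, prU_eq_expU]
  rw [expU_eq_avg _ j]
  simp only [hrestrict, Function.update_of_ne hij.symm, Function.update_comm hij]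

/-- The tangent-type inequality `y - m ≤ y log (y / m)`, in the form used for the potential
`m + y log (1 / m)`. -/
lemma add_mul_log_inv_le {m y : ℝ} (hm : 0 < m) (hy : 0 < y) :
    y + y * Real.log (1 / y) ≤ m + y * Real.log (1 / m) := by
  have h := Real.log_le_sub_one_of_pos (div_pos hm hy)
  rw [Real.log_div hm.ne' hy.ne'] at h
  have h' := mul_le_mul_of_nonneg_left h hy.le
  have hcancel : y * (m / y - 1) = m - y := by field_simp
  simp only [one_div, Real.log_inv]
  linarith

lemma max_le_add_mul_log_inv {m y : ℝ} (hm : 0 < m) (hm1 : m ≤ 1) (hy : 0 ≤ y) (hy1 : y ≤ 1) :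
    max m y ≤ m + y * Real.log (1 / m) := by
  have log_inv_nonneg : ∀ {t : ℝ}, 0 < t → t ≤ 1 → 0 ≤ Real.log (1 / t) := fun ht ht1 =>
    Real.log_nonneg ((one_le_div ht).2 ht1)
  rcases le_or_gt y m with h | h
  · rw [max_eq_left h]
    linarith [mul_nonneg hy (log_inv_nonneg hm hm1)]
  · have hy0 := hm.trans h
    rw [max_eq_right h.le]
    linarith [mul_nonneg hy (log_inv_nonneg hy0 hy1), add_mul_log_inv_le hm hy0]

/-- Potential-function bound on the running maximum of the path influences, started from an
arbitrary restriction `π` and truncated from below at `m`. -/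
lemma expU_max_maxPathInf_le (f : (ι → Bool) → Bool) (i : ι) (T : DTree ι) :
    ∀ (π : ι → Option Bool) {m : ℝ}, 0 < m → m ≤ 1 →
      expU (fun x => max m (maxPathInf f i π T (overlay π x))) ≤
        m + influence (restrictB f π) i * Real.log (1 / m) := by
  induction T with
  | leaf c =>
    intro π m hm hm1
    simp only [maxPathInf, expU_const]
    exact max_le_add_mul_log_inv hm hm1 (influence_nonneg _ _) (influence_le_one _ _)
  | node j t0 t1 ih0 ih1 =>
    intro π m hm hm1
    by_cases hij : j = i
    · simp only [maxPathInf, hij, if_true, expU_const]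
      exact max_le_add_mul_log_inv hm hm1 (influence_nonneg _ _) (influence_le_one _ _)
    simp only [maxPathInf, hij, if_false, ← max_assoc]
    have hstep : ∀ {M : ℝ}, 0 < M → M ≤ 1 →
        expU (fun x => max M (if overlay π x j then
          maxPathInf f i (Function.update π j (some true)) t1 (overlay π x)
          else maxPathInf f i (Function.update π j (some false)) t0 (overlay π x))) ≤
        M + influence (restrictB f π) i * Real.log (1 / M) := by
      intro M hM hM1
      cases hj : π j with
      | none =>
        rw [expU_eq_avg _ j, influence_restrictB_eq_avg f hij hj]
        have h1 := ih1 (Function.update π j (some true)) hM hM1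
        have h0 := ih0 (Function.update π j (some false)) hM hM1
        have hval : ∀ (b : Bool) (x : ι → Bool),
            overlay (Function.update π j (some b)) x j = b := fun b x => by simp [overlay]
        simp only [overlay_update π _ hj, hval, if_true, Bool.false_eq_true, if_false]
        linarith
      | some b =>
        have hval : ∀ x : ι → Bool, overlay π x j = b := fun x => by simp [overlay, hj]
        have hupd : Function.update π j (some b) = π := by
          rw [← hj, Function.update_eq_self]
        cases b
        · simpa only [hval, Bool.false_eq_true, if_false, hupd] using ih0 π hM hM1
        · simpa only [hval, if_true, hupd] using ih1 π hM hM1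
    rcases le_or_gt (influence (restrictB f π) i) m with h | h
    · rw [max_eq_left h]
      exact hstep hm hm1
    · rw [max_eq_right h.le]
      have hy0 := hm.trans h
      exact (hstep hy0 (influence_le_one _ _)).trans (add_mul_log_inv_le hm hy0)

/-- Let `a := Inf_i[f] ∈ (0,1]` and let `T` be any decision tree.  Then the expectation,
over a uniform random input `x`, of the maximum of the frozen influences
`Y_t = Inf_i[f_{π_s}]` along the computation path of `T` on `x` is at most
`a·(1 + ln(1/a))`. -/
theorem expected_max_path_influence_le {n : ℕ} (f : (Fin n → Bool) → Bool) (i : Fin n)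
    (T : DTree (Fin n)) {a : ℝ} (ha : influence f i = a) (ha0 : 0 < a) (ha1 : a ≤ 1) :
    expU (maxPathInf f i (fun _ => none) T) ≤ a * (1 + Real.log (1 / a)) := by
  have hbound := expU_max_maxPathInf_le f i T (fun _ => none) ha0 ha1
  have hrestrict : restrictB f (fun _ => none) = f := rfl
  rw [hrestrict, ha] at hbound
  calc expU (maxPathInf f i (fun _ => none) T)
      ≤ expU (fun x => max a (maxPathInf f i (fun _ => none) T (overlay (fun _ => none) x))) :=
        expU_mono fun x => le_max_right _ _
    _ ≤ a + a * Real.log (1 / a) := hbound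
    _ = a * (1 + Real.log (1 / a)) := by ring
end
end
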